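/- Let r ≥ 3 be an integer, let a = (0, …, 0, 2) be the vector of length r with r − 1 entries equal to 0 and last entry 2, and let b be the vector of length r with r − 3 entries equal to 1 and 3 entries equal to 2. Then σ_1(1, 1+a) = σ_1(0, b) and σ_2(1, 1+a) = σ_2(0, b), while a and b are not equal as multisets. -/

import Mathlib

/-- The `k`-th elementary symmetric polynomial of the tuple `v`. -/
def esymm {R : Type*} [CommSemiring R] {n : ℕ} (v : Fin n → R) (k : ℕ) : R :=
  ∑ S ∈ Finset.powersetCard k Finset.univ, ∏ j ∈ S, v j

theorem esymm_one_eq_sum {R : Type*} [CommSemiring R] {n : ℕ} (v : Fin n → R) :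
    esymm v 1 = ∑ i, v i := by
  simp [esymm, Finset.powersetCard_one]

theorem Finset.sq_sum_eq_sum_sq_add_two_mul {ι R : Type*} [CommSemiring R]
    (s : Finset ι) (v : ι → R) :
    (∑ i ∈ s, v i) ^ 2 = ∑ i ∈ s, v i ^ 2 + 2 * ∑ S ∈ s.powersetCard 2, ∏ j ∈ S, v j := by
  classical
  induction s using Finset.induction_on with
  | empty => simp [Finset.powersetCard_eq_empty.2 (show (∅ : Finset ι).card < 2 by simp)]
  | insert x s hx ih =>
    have hdisj : Disjoint (s.powersetCard 2) ((s.powersetCard 1).image (insert x)) := by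
      rw [Finset.disjoint_right]
      intro T hT hT'
      obtain ⟨U, -, rfl⟩ := Finset.mem_image.1 hT
      exact hx ((Finset.mem_powersetCard.1 hT').1 (Finset.mem_insert_self x U))
    have hpairs : ∑ S ∈ (s.powersetCard 1).image (insert x), ∏ j ∈ S, v j
        = v x * ∑ i ∈ s, v i := by
      rw [Finset.powersetCard_one, Finset.map_eq_image, Finset.image_image, Finset.sum_image,
        Finset.mul_sum]
      · refine Finset.sum_congr rfl fun i hi => ?_
        have hxi : x ≠ i := fun h => hx (h ▸ hi)
        exact Finset.prod_pair hxi
      · intro i hi j hj hij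
        have hmem : i ∈ ({x, j} : Finset ι) := by
          have hmem' : i ∈ ({x, i} : Finset ι) := by simp
          exact (show ({x, i} : Finset ι) = {x, j} from hij) ▸ hmem'
        rcases Finset.mem_insert.1 hmem with rfl | h
        · exact absurd hi hx
        · exact Finset.mem_singleton.1 h
    rw [Finset.powersetCard_succ_insert hx, Finset.sum_union hdisj, hpairs,
      Finset.sum_insert hx, Finset.sum_insert hx, add_sq, ih]
    ring

theorem sq_sum_eq_sum_sq_add_two_mul_esymm {R : Type*} [CommSemiring R] {n : ℕ}
    (v : Fin n → R) : (∑ i, v i) ^ 2 = ∑ i, v i ^ 2 + 2 * esymm v 2 :=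
  Finset.sq_sum_eq_sum_sq_add_two_mul _ v

/-- For `r ≥ 3`, `a = (0, …, 0, 2)` and `b = (1, …, 1, 2, 2, 2)` (with `r − 3` ones),
one has `σᵢ(1, 1+a) = σᵢ(0, b)` for `i = 1, 2`, while `a` and `b` are not equal as
multisets. -/
theorem stmt_15 (r : ℕ) (hr : 3 ≤ r) (a b : Fin r → ℕ)
    (ha : ∀ i, a i = if (i : ℕ) = r - 1 then 2 else 0)
    (hb : ∀ i, b i = if (i : ℕ) < r - 3 then 1 else 2) :
    esymm (Fin.cons (1 : ℤ) (fun j => 1 + (a j : ℤ))) 1 =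
        esymm (Fin.cons (0 : ℤ) (fun j => (b j : ℤ))) 1 ∧
      esymm (Fin.cons (1 : ℤ) (fun j => 1 + (a j : ℤ))) 2 =
        esymm (Fin.cons (0 : ℤ) (fun j => (b j : ℤ))) 2 ∧
      ¬∃ π : Equiv.Perm (Fin r), ∀ i, b i = a (π i) := by
  obtain ⟨k, rfl⟩ := Nat.exists_eq_add_of_le' hr
  have ha_init (i : Fin k) : a i.castSucc.castSucc.castSucc = 0 := by
    rw [ha, if_neg]; simp; omega
  have hb_init (i : Fin k) : b i.castSucc.castSucc.castSucc = 1 := by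
    rw [hb, if_pos]; simp
  have hsum : ∑ i, (Fin.cons (1 : ℤ) (fun j => 1 + (a j : ℤ)) : Fin (k + 4) → ℤ) i =
      ∑ i, (Fin.cons (0 : ℤ) (fun j => (b j : ℤ)) : Fin (k + 4) → ℤ) i := by
    rw [Fin.sum_univ_succ, Fin.sum_univ_succ (n := k + 3)]
    simp only [Fin.cons_zero, Fin.cons_succ, Fin.sum_univ_castSucc, ha_init, hb_init]
    simp [ha, hb]
    ring
  have hsq : ∑ i, (Fin.cons (1 : ℤ) (fun j => 1 + (a j : ℤ)) : Fin (k + 4) → ℤ) i ^ 2 =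
      ∑ i, (Fin.cons (0 : ℤ) (fun j => (b j : ℤ)) : Fin (k + 4) → ℤ) i ^ 2 := by
    rw [Fin.sum_univ_succ, Fin.sum_univ_succ (n := k + 3)]
    simp only [Fin.cons_zero, Fin.cons_succ, Fin.sum_univ_castSucc, ha_init, hb_init]
    simp [ha, hb]
    ring
  refine ⟨?_, ?_, ?_⟩
  · simpa only [esymm_one_eq_sum] using hsum
  · have h₁ := sq_sum_eq_sum_sq_add_two_mul_esymm
      (Fin.cons (1 : ℤ) (fun j => 1 + (a j : ℤ)) : Fin (k + 4) → ℤ)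
    have h₂ := sq_sum_eq_sum_sq_add_two_mul_esymm
      (Fin.cons (0 : ℤ) (fun j => (b j : ℤ)) : Fin (k + 4) → ℤ)
    rw [hsum, hsq] at h₁
    linarith
  · rintro ⟨π, hπ⟩
    have h := hπ (π.symm 0)
    rw [Equiv.apply_symm_apply, ha, hb] at h
    simp at h
    split_ifs at h
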